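/- Let h(x) = max(x,0), let τ_1,…,τ_N ∈ ℝ^d be unit vectors and a_1,…,a_N > 0, and let r ≥ 1 be a real number. Define f(x) = min{1, min_{1 ≤ j ≤ N} h(a_j(τ_j·x + 1/2) + 1)} and let χ be the indicator function of ⋂_{j=1}^{N} {x ∈ ℝ^d : τ_j·x ≥ −1/2}. Then ∫_{[−1,1]^d} |f(x) − χ(x)|^r dx ≤ √d · 2^{d−1} · Σ_{j=1}^{N} 1/a_j. -/

import Mathlib

open MeasureTheory
open scoped RealInnerProductSpace Classical

/-- A slab `{b < v·x < c}` meets the cube `[-1,1]^(n+1)` in a set of volume at most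
`2^n (c - b) / |v i|`, for every coordinate `i` with `v i ≠ 0`. -/
theorem volume_cube_inter_slab_le {n : ℕ} (i : Fin (n + 1)) (v : Fin (n + 1) → ℝ)
    (hv : v i ≠ 0) (b c : ℝ) :
    volume {x : Fin (n + 1) → ℝ |
        (∀ k, x k ∈ Set.Icc (-1 : ℝ) 1) ∧ ∑ k, v k * x k ∈ Set.Ioo b c} ≤
      ENNReal.ofReal ((c - b) / |v i|) * 2 ^ n := by
  set T : Set (ℝ × (Fin n → ℝ)) := {p | (∀ k, p.2 k ∈ Set.Icc (-1 : ℝ) 1) ∧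
    v i * p.1 + ∑ k, v (i.succAbove k) * p.2 k ∈ Set.Ioo b c} with hT
  have hTm : MeasurableSet T := by
    simp only [hT, Set.ofPred_and, Set.ofPred_forall]
    refine (MeasurableSet.iInter fun k => ?_).inter ?_
    · exact measurableSet_Icc.preimage
        ((measurable_pi_apply k).comp measurable_snd : Measurable fun p : ℝ × (Fin n → ℝ) => p.2 k)
    · exact measurableSet_Ioo.preimage (by fun_prop :
        Measurable fun p : ℝ × (Fin n → ℝ) => v i * p.1 + ∑ k, v (i.succAbove k) * p.2 k)
  have hsub : {x : Fin (n + 1) → ℝ |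
      (∀ k, x k ∈ Set.Icc (-1 : ℝ) 1) ∧ ∑ k, v k * x k ∈ Set.Ioo b c} ⊆
      MeasurableEquiv.piFinSuccAbove (fun _ => ℝ) i ⁻¹' T := by
    rintro x ⟨hx, hs⟩
    rw [Fin.sum_univ_succAbove _ i] at hs
    exact ⟨fun k => hx _, hs⟩
  have hfiber (y : Fin n → ℝ) : volume ((fun t => (t, y)) ⁻¹' T) ≤
      (Set.Icc (-1 : Fin n → ℝ) 1).indicator
        (fun _ => ENNReal.ofReal ((c - b) / |v i|)) y := by
    by_cases hy : y ∈ Set.Icc (-1 : Fin n → ℝ) 1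
    · rw [Set.indicator_of_mem hy]
      set s := ∑ k, v (i.succAbove k) * y k
      calc volume ((fun t => (t, y)) ⁻¹' T)
          ≤ volume ((v i * ·) ⁻¹' Set.Ioo (b - s) (c - s)) := by
            refine measure_mono fun t ht => ?_
            obtain ⟨-, h1, h2⟩ := ht
            simp only at h1 h2
            constructor <;> simp only <;> linarith
        _ = ENNReal.ofReal ((c - b) / |v i|) := by
            rw [Real.volume_preimage_mul_left hv, Real.volume_Ioo,
              ← ENNReal.ofReal_mul (abs_nonneg _), abs_inv]
            congr 1
            ring
    · rw [Set.indicator_of_notMem hy, nonpos_iff_eq_zero]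
      refine measure_mono_null (t := ∅) (fun t ht => hy ?_) measure_empty
      exact ⟨fun k => (ht.1 k).1, fun k => (ht.1 k).2⟩
  calc _ ≤ volume (MeasurableEquiv.piFinSuccAbove (fun _ => ℝ) i ⁻¹' T) := measure_mono hsub
    _ = (volume : Measure (ℝ × (Fin n → ℝ))) T :=
        (volume_preserving_piFinSuccAbove (fun _ => ℝ) i).measure_preimage hTm.nullMeasurableSet
    _ = ∫⁻ y, volume ((fun t => (t, y)) ⁻¹' T) := Measure.prod_apply_symm hTm
    _ ≤ ∫⁻ y, (Set.Icc (-1 : Fin n → ℝ) 1).indicator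
        (fun _ => ENNReal.ofReal ((c - b) / |v i|)) y := lintegral_mono hfiber
    _ = ENNReal.ofReal ((c - b) / |v i|) * 2 ^ n := by
        rw [lintegral_indicator_const measurableSet_Icc, Real.volume_Icc_pi]
        norm_num

/-- A unit vector of `ℝ^d` has a coordinate of absolute value at least `1 / √d`. -/
theorem exists_one_le_sqrt_mul_abs_coord {d : ℕ} (v : EuclideanSpace ℝ (Fin d)) (hv : ‖v‖ = 1) :
    ∃ i, 1 ≤ Real.sqrt d * |v i| := by
  by_contra! h
  have hd : d ≠ 0 := by
    rintro rfl
    simp [Subsingleton.elim v 0] at hv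
  have : Nonempty (Fin d) := ⟨⟨0, Nat.pos_of_ne_zero hd⟩⟩
  have hsum : ∑ i, v i ^ 2 = 1 := by
    rw [← EuclideanSpace.real_norm_sq_eq, hv, one_pow]
  have hlt : ∑ i, (d : ℝ) * v i ^ 2 < ∑ _i : Fin d, (1 : ℝ) := by
    refine Finset.sum_lt_sum_of_nonempty Finset.univ_nonempty fun i _ => ?_
    have := pow_lt_one₀ (by positivity) (h i) two_ne_zero
    rwa [mul_pow, Real.sq_sqrt d.cast_nonneg, sq_abs] at this
  simp [← Finset.mul_sum, hsum] at hlt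

/-- A slab of width `c - b` with unit normal vector meets the cube `[-1,1]^d` in a set of volume at
most `√d 2^(d-1) (c - b)`. -/
theorem volume_real_cube_inter_slab_le {d : ℕ} (v : EuclideanSpace ℝ (Fin d)) (hv : ‖v‖ = 1)
    {b c : ℝ} (hbc : b ≤ c) :
    volume.real {x : EuclideanSpace ℝ (Fin d) |
        (∀ i, x i ∈ Set.Icc (-1 : ℝ) 1) ∧ ⟪v, x⟫ ∈ Set.Ioo b c} ≤
      Real.sqrt d * 2 ^ (d - 1) * (c - b) := by
  obtain ⟨i, hi⟩ := exists_one_le_sqrt_mul_abs_coord v hv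
  obtain _ | n := d
  · exact i.elim0
  have hvi : 0 < |v i| := by
    by_contra! h
    nlinarith [Real.sqrt_nonneg ((n + 1 : ℕ) : ℝ)]
  have hvol : volume {x : EuclideanSpace ℝ (Fin (n + 1)) |
      (∀ i, x i ∈ Set.Icc (-1 : ℝ) 1) ∧ ⟪v, x⟫ ∈ Set.Ioo b c} ≤
      ENNReal.ofReal ((c - b) / |v i|) * 2 ^ n := by
    have hmp := EuclideanSpace.volume_preserving_symm_measurableEquiv_toLp (Fin (n + 1))
    refine le_trans (le_of_eq ?_)
      (volume_cube_inter_slab_le i (fun k => v k) (abs_pos.mp hvi) b c)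
    rw [← hmp.measure_preimage_equiv]
    congr 1
    ext x
    simp [PiLp.inner_apply, mul_comm]
  calc _ ≤ (ENNReal.ofReal ((c - b) / |v i|) * 2 ^ n).toReal :=
        ENNReal.toReal_mono (by finiteness) hvol
    _ = (c - b) / |v i| * 2 ^ n := by
        rw [ENNReal.toReal_mul, ENNReal.toReal_ofReal (by have := sub_nonneg.2 hbc; positivity)]
        simp
    _ ≤ (Real.sqrt (n + 1 : ℕ) * (c - b)) * 2 ^ n := by
        gcongr
        rw [div_le_iff₀ hvi]
        nlinarith [sub_nonneg.2 hbc]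
    _ = _ := by
        rw [Nat.add_sub_cancel]
        ring

/-- The `L^r` distance (to the `r`-th power) on `[-1,1]^d` between the network
`f(x) = min{1, min_j h(a_j(τ_j·x + 1/2) + 1)}` and the indicator `χ` of
`⋂_j {x : τ_j·x ≥ -1/2}` is at most `√d · 2^{d-1} · Σ_j 1/a_j`. -/
theorem network_Lr_bound (d N : ℕ) (hN : 1 ≤ N)
    (τ : ℕ → EuclideanSpace ℝ (Fin d)) (hτ : ∀ j ∈ Finset.Icc 1 N, ‖τ j‖ = 1)
    (a : ℕ → ℝ) (ha : ∀ j ∈ Finset.Icc 1 N, 0 < a j)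
    (r : ℝ) (hr : 1 ≤ r)
    (f : EuclideanSpace ℝ (Fin d) → ℝ)
    (hf : ∀ x, f x = min 1 ((Finset.Icc 1 N).inf' (Finset.nonempty_Icc.mpr hN)
      fun j => max (a j * (⟪τ j, x⟫ + 1 / 2) + 1) 0))
    (χ : EuclideanSpace ℝ (Fin d) → ℝ)
    (hχ : ∀ x, χ x = if ∀ j ∈ Finset.Icc 1 N, -(1 / 2) ≤ ⟪τ j, x⟫ then 1 else 0) :
    ∫ x in {x : EuclideanSpace ℝ (Fin d) | ∀ i, x i ∈ Set.Icc (-1 : ℝ) 1},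
        |f x - χ x| ^ r ≤
      Real.sqrt d * 2 ^ (d - 1) * ∑ j ∈ Finset.Icc 1 N, 1 / a j := by
  set C := {x : EuclideanSpace ℝ (Fin d) | ∀ i, x i ∈ Set.Icc (-1 : ℝ) 1} with hC
  let S : ℕ → Set (EuclideanSpace ℝ (Fin d)) := fun j =>
    {x | ⟪τ j, x⟫ ∈ Set.Ioo (-(1 / 2) - 1 / a j) (-(1 / 2))}
  have hSm (j : ℕ) : MeasurableSet (S j) := measurableSet_Ioo.preimage (by fun_prop)
  have hCfin : volume C ≠ ⊤ := by
    have hmp := EuclideanSpace.volume_preserving_symm_measurableEquiv_toLp (Fin d)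
    have hpre : C = (MeasurableEquiv.toLp 2 (Fin d → ℝ)).symm ⁻¹' Set.Icc (-1) 1 := by
      ext x
      simp [hC, Pi.le_def, forall_and]
    rw [hpre, hmp.measure_preimage_equiv]
    exact isCompact_Icc.measure_lt_top.ne
  have hpt (x : EuclideanSpace ℝ (Fin d)) :
      |f x - χ x| ^ r ≤ ∑ j ∈ Finset.Icc 1 N, (S j).indicator (fun _ => (1 : ℝ)) x := by
    have hnonneg : ∀ j ∈ Finset.Icc 1 N, 0 ≤ (S j).indicator (fun _ => (1 : ℝ)) x :=
      fun j _ => Set.indicator_nonneg (fun _ _ => zero_le_one) x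
    by_cases hfx : f x - χ x = 0
    · rw [hfx, abs_zero, Real.zero_rpow (by linarith)]
      exact Finset.sum_nonneg hnonneg
    have hf0 : 0 ≤ f x := by
      rw [hf]
      exact le_min zero_le_one (Finset.le_inf' _ _ fun j _ => le_max_right _ _)
    have hf1 : f x ≤ 1 := hf x ▸ min_le_left _ _
    by_cases hx : ∀ j ∈ Finset.Icc 1 N, -(1 / 2) ≤ ⟪τ j, x⟫
    · refine absurd ?_ hfx
      rw [hχ, if_pos hx, hf, sub_eq_zero, min_eq_left]
      refine Finset.le_inf' _ _ fun j hj => le_max_of_le_left ?_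
      have := mul_nonneg (ha j hj).le (by linarith [hx j hj] : 0 ≤ ⟪τ j, x⟫ + 1 / 2)
      linarith
    · rw [hχ, if_neg hx, sub_zero] at hfx ⊢
      push Not at hx
      obtain ⟨j, hj, hjx⟩ := hx
      have hpos : 0 < max (a j * (⟪τ j, x⟫ + 1 / 2) + 1) 0 := by
        refine (lt_of_le_of_ne hf0 (Ne.symm hfx)).trans_le ?_
        rw [hf]
        exact (min_le_right _ _).trans (Finset.inf'_le _ hj)
      have hpos' : 0 < a j * (⟪τ j, x⟫ + 1 / 2) + 1 := by simpa using hpos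
      have hxS : x ∈ S j := by
        refine ⟨?_, hjx⟩
        have := ha j hj
        have h : -1 / a j < ⟪τ j, x⟫ + 1 / 2 := by
          rw [div_lt_iff₀ this]
          linarith
        rw [neg_div] at h
        linarith
      calc |f x| ^ r ≤ 1 :=
            Real.rpow_le_one (abs_nonneg _) (by rwa [abs_of_nonneg hf0]) (by linarith)
        _ = (S j).indicator (fun _ => (1 : ℝ)) x := by rw [Set.indicator_of_mem hxS]
        _ ≤ _ := Finset.single_le_sum hnonneg hj
  have hint (j : ℕ) : Integrable ((S j).indicator fun _ => (1 : ℝ)) (volume.restrict C) := by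
    have : IsFiniteMeasure (volume.restrict C) := isFiniteMeasure_restrict.2 hCfin
    exact (integrable_const _).indicator (hSm j)
  calc ∫ x in C, |f x - χ x| ^ r
      ≤ ∫ x in C, ∑ j ∈ Finset.Icc 1 N, (S j).indicator (fun _ => (1 : ℝ)) x :=
        integral_mono_of_nonneg (.of_forall fun x => by positivity)
          (integrable_finsetSum _ fun j _ => hint j) (.of_forall hpt)
    _ = ∑ j ∈ Finset.Icc 1 N, volume.real (C ∩ S j) := by
        rw [integral_finsetSum _ fun j _ => hint j]
        refine Finset.sum_congr rfl fun j _ => ?_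
        rw [integral_indicator_const _ (hSm j), measureReal_restrict_apply (hSm j),
          smul_eq_mul, mul_one, Set.inter_comm]
    _ ≤ ∑ j ∈ Finset.Icc 1 N, Real.sqrt d * 2 ^ (d - 1) * (1 / a j) := by
        refine Finset.sum_le_sum fun j hj => ?_
        have haj := one_div_pos.2 (ha j hj)
        refine (volume_real_cube_inter_slab_le (τ j) (hτ j hj)
          (by linarith : -(1 / 2) - 1 / a j ≤ -(1 / 2))).trans_eq ?_
        ring
    _ = _ := by rw [Finset.mul_sum]
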